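/- Let A = ⊕_{n≥0} A_n be a positively graded finite-dimensional k-algebra with c ≥ 1 whose 0-th component algebra A_0 is basic. Then the following are equivalent: (1) A is graded Frobenius, i.e., there is an isomorphism _AA ≅ D(A_A)(−c) of graded left A-modules; (2) A is self-injective (injective as a left module over itself) and A_c is a faithful left A_0-module; (3) A is well-graded and self-injective. -/

import Mathlib

/-!
STATEMENT 8: Let `A = ⊕_{n≥0} A_n` be a positively graded finite-dimensional
`k`-algebra with `c ≥ 1` whose degree-zero component `A_0` is basic.  TFAE:
(1) `A` is graded Frobenius: `_AA ≅ D(A_A)(−c)` as graded left `A`-modules;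
(2) `A` is self-injective and `A_c` is a faithful left `A_0`-module;
(3) `A` is well-graded and self-injective.

Here `D(A_A)` is the `k`-linear dual of `A` with left `A`-action `(a • f) y = f (y * a)`
and grading `D(A)_n = D(A_{-n})`; an `A`-linear isomorphism `φ : A ≃ D(A_A)` is graded of
degree `(-c)` precisely when `φ x` kills `A_m` whenever `x ∈ A_n` and `n + m ≠ c`.
-/

open MulOpposite

section Dual
variable (k : Type) [Field k] (B : Type) [Ring B] [Algebra k B]

/-- The left `B`-action on `D(B) = Hom_k(B,k)`: `(b • f) y = f (y * b)`. -/
noncomputable instance dualLeftModule : Module B (Module.Dual k B) where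
  smul b f := f.comp (LinearMap.mulRight k b)
  one_smul f := by ext y; show f (y * 1) = f y; rw [mul_one]
  mul_smul b b' f := by ext y; show f (y * (b * b')) = f (y * b * b'); rw [mul_assoc]
  smul_zero b := rfl
  smul_add b f g := rfl
  add_smul b b' f := by ext y; show f (y * (b + b')) = f (y * b) + f (y * b'); rw [mul_add, map_add]
  zero_smul f := by ext y; show f (y * 0) = 0; rw [mul_zero, map_zero]

/-- The right `B`-action on `D(B)`: `(f • b) y = f (b * y)`. -/
noncomputable instance dualRightModule : Module Bᵐᵒᵖ (Module.Dual k B) where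
  smul b f := f.comp (LinearMap.mulLeft k (unop b))
  one_smul f := by ext y; show f (1 * y) = f y; rw [one_mul]
  mul_smul b b' f := by
    ext y; show f ((unop b' * unop b) * y) = f (unop b' * (unop b * y)); rw [mul_assoc]
  smul_zero b := rfl
  smul_add b f g := rfl
  add_smul b b' f := by
    ext y; show f ((unop b + unop b') * y) = f (unop b * y) + f (unop b' * y)
    rw [add_mul, map_add]
  zero_smul f := by ext y; show f (0 * y) = 0; rw [zero_mul, map_zero]

instance : SMulCommClass B Bᵐᵒᵖ (Module.Dual k B) where
  smul_comm b b' f := by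
    ext y; show f (unop b' * (y * b)) = f ((unop b' * y) * b); rw [mul_assoc]

instance : IsScalarTower k B (Module.Dual k B) where
  smul_assoc r b f := by
    ext y; show f (y * (r • b)) = r • f (y * b)
    rw [mul_smul_comm, map_smul]

instance : IsScalarTower k Bᵐᵒᵖ (Module.Dual k B) where
  smul_assoc r b f := by
    ext y
    show f ((unop (r • b)) * y) = r • f (unop b * y)
    rw [unop_smul, smul_mul_assoc, map_smul]

end Dual

/-- `A` is left well-graded: `e · A_c ≠ 0` for every nonzero idempotent `e ∈ A_0`. -/
def LeftWellGraded {k A : Type} [Field k] [Ring A] [Algebra k A]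
    (𝒜 : ℕ → Submodule k A) (c : ℕ) : Prop :=
  ∀ e : A, e ∈ 𝒜 0 → IsIdempotentElem e → e ≠ 0 → ∃ x ∈ 𝒜 c, e * x ≠ 0

/-- `A` is right well-graded: `A_c · e ≠ 0` for every nonzero idempotent `e ∈ A_0`. -/
def RightWellGraded {k A : Type} [Field k] [Ring A] [Algebra k A]
    (𝒜 : ℕ → Submodule k A) (c : ℕ) : Prop :=
  ∀ e : A, e ∈ 𝒜 0 → IsIdempotentElem e → e ≠ 0 → ∃ x ∈ 𝒜 c, x * e ≠ 0

/-- `e` is a primitive idempotent. -/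
def IsPrimitiveIdem {B : Type} [Ring B] (e : B) : Prop :=
  IsIdempotentElem e ∧ e ≠ 0 ∧
    ∀ f g : B, IsIdempotentElem f → IsIdempotentElem g → f ≠ 0 → g ≠ 0 →
      f * g = 0 → g * f = 0 → e ≠ f + g

/-- The left ideal `Be`. -/
def leftIdeal {B : Type} [Ring B] (e : B) : Submodule B B :=
  LinearMap.range (LinearMap.toSpanSingleton B B e)

/-- A ring is basic if in any decomposition of the unity into pairwise orthogonal
primitive idempotents, distinct idempotents generate non-isomorphic left ideals. -/
def IsBasicAlgebra (B : Type) [Ring B] : Prop :=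
  ∀ (l : ℕ) (e : Fin l → B), (∀ i, IsPrimitiveIdem (e i)) →
    (∀ i j, i ≠ j → e i * e j = 0) → (∑ i, e i = 1) →
    ∀ i j, i ≠ j → IsEmpty (↥(leftIdeal (e i)) ≃ₗ[B] ↥(leftIdeal (e j)))

section PrimitiveIdempotents

variable {R : Type} [Ring R]

/-- Every element of a finite-dimensional algebra is strongly `π`-regular. -/
theorem exists_pow_eq_pow_succ_mul (k : Type) [Field k] [Algebra k R] [FiniteDimensional k R]
    (r : R) : ∃ (n : ℕ) (p : R), Commute r p ∧ r ^ n = r ^ (n + 1) * p := by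
  have : IsMulCommutative (Algebra.adjoin k {r}) := Algebra.isMulCommutative_adjoin k (by
    intro a ha b hb
    rw [Set.mem_singleton_iff.1 ha, Set.mem_singleton_iff.1 hb])
  have : IsArtinianRing (Algebra.adjoin k {r}) := IsArtinianRing.of_finite k _
  let x : Algebra.adjoin k {r} := ⟨r, Algebra.self_mem_adjoin_singleton k r⟩
  obtain ⟨n, y, hy⟩ := IsArtinian.exists_pow_succ_smul_dvd x (1 : Algebra.adjoin k {r})
  refine ⟨n, y, congrArg Subtype.val (mul_comm x y), ?_⟩
  have h := congrArg Subtype.val hy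
  simpa [x] using h.symm

/-- Fitting's lemma for corner rings: an element of `eRe` with `e` a primitive idempotent is
nilpotent or invertible in `eRe`. -/
theorem IsPrimitiveIdem.isNilpotent_or_exists_inverse (k : Type) [Field k] [Algebra k R]
    [FiniteDimensional k R] {e : R} (he : IsPrimitiveIdem e) (r : R) :
    IsNilpotent (e * r * e) ∨ ∃ u, u * (e * r * e) = e ∧ (e * r * e) * u = e := by
  obtain ⟨hee, he0, hprim⟩ := he
  obtain ⟨z, hz⟩ : ∃ z, z = e * r * e := ⟨_, rfl⟩
  rw [← hz]
  have hez : e * z = z := by rw [hz, ← mul_assoc, ← mul_assoc, hee.eq]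
  have hze : z * e = z := by rw [hz, mul_assoc, hee.eq]
  obtain ⟨n, p, hcomm, hn⟩ := exists_pow_eq_pow_succ_mul k z
  have hm : z ^ (n + 1) = z ^ (n + 2) * p := by
    rw [pow_succ' z n, pow_succ' z (n + 1), mul_assoc, ← hn]
  have hj : ∀ j, z ^ (n + 1) = z ^ (n + 1 + j) * p ^ j := by
    intro j
    induction j with
    | zero => simp
    | succ j ih =>
      calc z ^ (n + 1) = z ^ (n + 1 + j) * p ^ j := ih
        _ = z ^ j * z ^ (n + 1) * p ^ j := by rw [← pow_add, add_comm j]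
        _ = z ^ j * (z ^ (n + 2) * p) * p ^ j := by rw [← hm]
        _ = z ^ (n + 1 + (j + 1)) * p ^ (j + 1) := by
          rw [pow_succ' p j, show n + 1 + (j + 1) = j + (n + 2) by omega, pow_add z j]
          simp only [mul_assoc]
  have hcp : ∀ a b : ℕ, z ^ a * p ^ b = p ^ b * z ^ a := fun a b => (hcomm.pow_pow a b).eq
  obtain ⟨g, hg⟩ : ∃ g, g = z ^ (n + 1) * p ^ (n + 1) := ⟨_, rfl⟩
  have hzg : z ^ (n + 1) * g = z ^ (n + 1) := by
    rw [hg, ← mul_assoc, ← pow_add, ← hj]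
  have hgg : g * g = g := by
    calc g * g = p ^ (n + 1) * (z ^ (n + 1) * g) := by rw [← mul_assoc, ← hcp, ← hg]
      _ = g := by rw [hzg, ← hcp, ← hg]
  have heg : e * g = g := by rw [hg, pow_succ', ← mul_assoc, ← mul_assoc, hez]
  have hge : g * e = g := by rw [hg, hcp, pow_succ z, mul_assoc, mul_assoc, hze]
  by_cases hg0 : g = 0
  · left
    exact ⟨n + 1, by rw [← hzg, hg0, mul_zero]⟩
  by_cases hd : e - g = 0
  · right
    have hge' : g = e := (sub_eq_zero.1 hd).symm
    refine ⟨z ^ n * p ^ (n + 1), ?_, ?_⟩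
    · rw [hcp, mul_assoc, ← pow_succ, ← hcp, ← hg, hge']
    · rw [← mul_assoc, ← pow_succ', ← hg, hge']
  · exfalso
    refine hprim g (e - g) hgg ?_ hg0 hd ?_ ?_ (by abel)
    · show (e - g) * (e - g) = e - g
      rw [mul_sub, sub_mul, sub_mul, hee.eq, hge, heg, hgg, sub_self, sub_zero]
    · rw [mul_sub, hge, hgg, sub_self]
    · rw [sub_mul, heg, hgg, sub_self]

/-- Every idempotent of a left Artinian ring is a sum of orthogonal primitive idempotents. -/
theorem IsIdempotentElem.exists_primitive_decomposition [IsArtinianRing R] (e : R)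
    (he : IsIdempotentElem e) :
    ∃ (ι : Type) (_ : Fintype ι) (p : ι → R), (∀ i, IsPrimitiveIdem (p i)) ∧
      (∀ i j, i ≠ j → p i * p j = 0) ∧ ∑ i, p i = e := by
  induction h : Ideal.span {e} using WellFoundedLT.induction generalizing e with
  | ind I ih =>
  subst h
  by_cases he0 : e = 0
  · exact ⟨Empty, inferInstance, fun i => i.elim, fun i => i.elim, fun i => i.elim, by simp [he0]⟩
  by_cases hp : IsPrimitiveIdem e
  · exact ⟨Unit, inferInstance, fun _ => e, fun _ => hp, fun i j hij => (hij rfl).elim, by simp⟩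
  have hsplit : ∃ f g : R, IsIdempotentElem f ∧ IsIdempotentElem g ∧ f ≠ 0 ∧ g ≠ 0 ∧
      f * g = 0 ∧ g * f = 0 ∧ e = f + g := by
    by_contra hcon
    refine hp ⟨he, he0, fun f g hf hg hf0 hg0 hfg hgf hsum => hcon ?_⟩
    exact ⟨f, g, hf, hg, hf0, hg0, hfg, hgf, hsum⟩
  have hlt : ∀ f g : R, IsIdempotentElem f → IsIdempotentElem g → g ≠ 0 → f * g = 0 →
      e = f + g → Ideal.span {f} < Ideal.span {e} := by
    intro f g hf hg hg0 hfg hsum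
    refine lt_of_le_of_ne ?_ fun heq => ?_
    · rw [Ideal.span_singleton_le_iff_mem, Ideal.mem_span_singleton']
      exact ⟨f, by rw [hsum, mul_add, hf.eq, hfg, add_zero]⟩
    · have hmem : e ∈ Ideal.span {f} := heq ▸ Ideal.mem_span_singleton_self e
      obtain ⟨a, ha⟩ := Ideal.mem_span_singleton'.1 hmem
      apply hg0
      calc g = e * g := by rw [hsum, add_mul, hfg, hg.eq, zero_add]
        _ = 0 := by rw [← ha, mul_assoc, hfg, mul_zero]
  obtain ⟨f, g, hf, hg, hf0, hg0, hfg, hgf, hsum⟩ := hsplit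
  obtain ⟨ι, _, p, hp1, hp2, hp3⟩ := ih _ (hlt f g hf hg hg0 hfg hsum) f hf rfl
  obtain ⟨κ, _, q, hq1, hq2, hq3⟩ :=
    ih _ (hlt g f hg hf hf0 hgf (by rw [hsum, add_comm])) g hg rfl
  classical
  have hpl : ∀ i, f * p i = p i ∧ p i * f = p i := by
    intro i
    rw [← hp3, Finset.sum_mul, Finset.mul_sum]
    constructor <;> rw [Finset.sum_eq_single i (fun j _ hj => hp2 _ _ (by tauto)) (by simp)] <;>
      exact (hp1 i).1
  have hql : ∀ i, g * q i = q i ∧ q i * g = q i := by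
    intro i
    rw [← hq3, Finset.sum_mul, Finset.mul_sum]
    constructor <;> rw [Finset.sum_eq_single i (fun j _ hj => hq2 _ _ (by tauto)) (by simp)] <;>
      exact (hq1 i).1
  refine ⟨ι ⊕ κ, inferInstance, Sum.elim p q, ?_, ?_, ?_⟩
  · rintro (i | i)
    exacts [hp1 i, hq1 i]
  · rintro (i | i) (j | j) hij
    · exact hp2 i j (fun h => hij (by rw [h]))
    · show p i * q j = 0
      rw [← (hpl i).2, ← (hql j).1, mul_assoc, ← mul_assoc f, hfg, zero_mul, mul_zero]
    · show q i * p j = 0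
      rw [← (hql i).2, ← (hpl j).1, mul_assoc, ← mul_assoc g, hgf, zero_mul, mul_zero]
    · exact hq2 i j (fun h => hij (by rw [h]))
  · rw [Fintype.sum_sum_type]
    simp [hp3, hq3, hsum]

/-- Elements `p ∈ eRf` and `q ∈ fRe` with `pq = e` and `qp = f` induce an isomorphism
`Re ≃ Rf`. -/
def leftIdealEquiv {e f p q : R} (hep : e * p = p) (hpf : p * f = p) (hfq : f * q = q)
    (hqe : q * e = q) (hpq : p * q = e) (hqp : q * p = f) :
    ↥(leftIdeal e) ≃ₗ[R] ↥(leftIdeal f) where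
  toFun x := ⟨x * p, x * p, by
    show x * p * f = x * p
    rw [mul_assoc, hpf]⟩
  invFun x := ⟨x * q, x * q, by
    show x * q * e = x * q
    rw [mul_assoc, hqe]⟩
  map_add' x y := Subtype.ext (add_mul (x : R) y p)
  map_smul' a x := Subtype.ext (mul_assoc a (x : R) p)
  left_inv := by
    rintro ⟨x, a, rfl⟩
    apply Subtype.ext
    show a * e * p * q = a * e
    rw [mul_assoc a, hep, mul_assoc, hpq]
  right_inv := by
    rintro ⟨x, a, rfl⟩
    apply Subtype.ext
    show a * f * q * p = a * f
    rw [mul_assoc a, hfq, mul_assoc, hqp]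

/-- A product `e r f t e` is nilpotent when the primitive idempotents `e`, `f` generate
non-isomorphic left ideals. -/
theorem IsPrimitiveIdem.isNilpotent_of_isEmpty_equiv (k : Type) [Field k] [Algebra k R]
    [FiniteDimensional k R] {e f : R} (he : IsPrimitiveIdem e) (hf : IsPrimitiveIdem f)
    (hef : IsEmpty (↥(leftIdeal e) ≃ₗ[R] ↥(leftIdeal f))) (r t : R) :
    IsNilpotent (e * r * f * t * e) := by
  have hz : e * r * f * t * e = e * (r * f * t) * e := by simp only [mul_assoc]
  rw [hz]
  refine (he.isNilpotent_or_exists_inverse k (r * f * t)).resolve_right ?_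
  rintro ⟨u, -, hu⟩
  obtain ⟨hee, he0, -⟩ := he
  have hff := hf.1
  obtain ⟨p, hp⟩ : ∃ p, p = e * r * f := ⟨_, rfl⟩
  obtain ⟨q, hq⟩ : ∃ q, q = f * t * e * u * e := ⟨_, rfl⟩
  have hep : e * p = p := by rw [hp, ← mul_assoc, ← mul_assoc, hee.eq]
  have hpf : p * f = p := by rw [hp, mul_assoc, hff.eq]
  have hfq : f * q = q := by simp only [hq, ← mul_assoc, hff.eq]
  have hqe : q * e = q := by rw [hq, mul_assoc, hee.eq]
  have hpq : p * q = e := by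
    calc p * q = e * (r * (f * f) * t) * e * u * e := by rw [hp, hq]; simp only [mul_assoc]
      _ = e := by rw [hff.eq, hu, hee.eq]
  have hqp0 : q * p ≠ 0 := fun h0 => he0 <| by
    calc e = p * q * (p * q) := by rw [hpq, hee.eq]
      _ = p * (q * p) * q := by simp only [mul_assoc]
      _ = 0 := by rw [h0, mul_zero, zero_mul]
  have hgg : q * p * (q * p) = q * p := by
    rw [mul_assoc, ← mul_assoc p, hpq, hep]
  have hfg : f * (q * p) = q * p := by rw [← mul_assoc, hfq]
  have hgf : q * p * f = q * p := by rw [mul_assoc, hpf]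
  have hqp : q * p = f := by
    by_contra hne
    refine hf.2.2 (q * p) (f - q * p) hgg ?_ hqp0 (sub_ne_zero.2 (Ne.symm hne)) ?_ ?_ (by abel)
    · show (f - q * p) * (f - q * p) = f - q * p
      rw [mul_sub, sub_mul, sub_mul, hff.eq, hgf, hfg, hgg, sub_self, sub_zero]
    · rw [mul_sub, hgf, hgg, sub_self]
    · rw [sub_mul, hfg, hgg, sub_self]
  exact hef.elim (leftIdealEquiv hep hpf hfq hqe hpq hqp)

end PrimitiveIdempotents

section SelfInjective

variable {A : Type} [Ring A]

/-- `x` generates a simple left ideal. -/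
def GeneratesSimple (x : A) : Prop := x ≠ 0 ∧ ∀ a, a * x ≠ 0 → ∃ b, b * (a * x) = x

theorem GeneratesSimple.mul_left {x : A} (hx : GeneratesSimple x) {a : A} (ha : a * x ≠ 0) :
    GeneratesSimple (a * x) := by
  refine ⟨ha, fun b hb => ?_⟩
  rw [← mul_assoc] at hb ⊢
  obtain ⟨d, hd⟩ := hx.2 (b * a) hb
  exact ⟨a * d, by rw [mul_assoc, hd]⟩

theorem exists_mul_generatesSimple [IsArtinianRing A] {x : A} (hx : x ≠ 0) :
    ∃ a, GeneratesSimple (a * x) := by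
  have hne : Ideal.span {x} ≠ ⊥ := by simpa using hx
  obtain ⟨S, hS, hle⟩ := (eq_bot_or_exists_atom_le (Ideal.span {x})).resolve_left hne
  obtain ⟨s, hs, hs0⟩ := Submodule.exists_mem_ne_zero_of_ne_bot hS.1
  obtain ⟨a, rfl⟩ := Ideal.mem_span_singleton'.1 (hle hs)
  refine ⟨a, hs0, fun b hb => ?_⟩
  have hle' : Ideal.span {b * (a * x)} ≤ S := by
    rw [Ideal.span_singleton_le_iff_mem]
    exact S.mul_mem_left b hs
  have heq : Ideal.span {b * (a * x)} = S := (hS.le_iff.1 hle').resolve_left (by simpa using hb)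
  rw [← heq] at hs
  exact Ideal.mem_span_singleton'.1 hs

/-- In a left self-injective ring, `x A` is the right annihilator of the left annihilator
of `x`. -/
theorem Module.Injective.exists_mul_eq (hinj : Module.Injective A A) {x z : A}
    (h : ∀ a, a * x = 0 → a * z = 0) : ∃ r, z = x * r := by
  let I : Submodule A A := LinearMap.ker (LinearMap.toSpanSingleton A A x)
  let f : (A ⧸ I) →ₗ[A] A := I.liftQ (LinearMap.toSpanSingleton A A x) le_rfl
  let g : (A ⧸ I) →ₗ[A] A := I.liftQ (LinearMap.toSpanSingleton A A z) (fun a ha => h a ha)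
  obtain ⟨φ, hφ⟩ := hinj.out f (LinearMap.ker_eq_bot.1 (Submodule.ker_liftQ_eq_bot' _ _ rfl)) g
  refine ⟨φ 1, ?_⟩
  have h1 := hφ (I.mkQ 1)
  have hf : f (I.mkQ 1) = x := one_smul A x
  have hg : g (I.mkQ 1) = z := one_smul A z
  rw [hf, hg] at h1
  rw [← h1, ← smul_eq_mul, ← map_smul, smul_eq_mul, mul_one]

/-- In a left self-injective ring, the projection of `Ax ⊕ Ay` onto `Ax` is a right
multiplication. -/
theorem Module.Injective.exists_mul_eq_self_and_mul_eq_zero (hinj : Module.Injective A A)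
    {x y : A} (h : ∀ a b, a * x = b * y → a * x = 0) : ∃ r, x * r = x ∧ y * r = 0 := by
  let X : Submodule A A := Ideal.span {x}
  let Y : Submodule A A := Ideal.span {y}
  let f : (X × Y) →ₗ[A] A := X.subtype.coprod Y.subtype
  have hf : Function.Injective f := by
    rw [injective_iff_map_eq_zero]
    rintro ⟨⟨u, hu⟩, ⟨v, hv⟩⟩ huv
    replace huv : u + v = 0 := by simpa [f] using huv
    obtain ⟨a, rfl⟩ := Ideal.mem_span_singleton'.1 hu
    obtain ⟨b, rfl⟩ := Ideal.mem_span_singleton'.1 hv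
    have h0 : a * x = 0 := h a (-b) (by rw [neg_mul]; exact eq_neg_of_add_eq_zero_left huv)
    have h1 : b * y = 0 := by simpa [h0] using huv
    simp [h0, h1]
  obtain ⟨φ, hφ⟩ := hinj.out f hf (X.subtype ∘ₗ LinearMap.fst A X Y)
  have hmul : ∀ a, a * φ 1 = φ a := fun a => by
    rw [← smul_eq_mul, ← map_smul, smul_eq_mul, mul_one]
  refine ⟨φ 1, ?_, ?_⟩
  · have h1 := hφ (⟨x, Ideal.mem_span_singleton_self x⟩, 0)
    simpa [f, hmul] using h1
  · have h1 := hφ (0, ⟨y, Ideal.mem_span_singleton_self y⟩)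
    simpa [f, hmul] using h1

end SelfInjective

section DegreeFiltration

variable {k A : Type} [Field k] [Ring A] [Algebra k A] (𝒜 : ℕ → Submodule k A)

/-- The part `A_{≥ m}` of a graded algebra. -/
def degreeGE (m : ℕ) : Submodule k A := ⨆ n : {n : ℕ // m ≤ n}, 𝒜 n

variable {𝒜}

theorem mem_degreeGE_of_mem {m n : ℕ} (h : m ≤ n) {x : A} (hx : x ∈ 𝒜 n) : x ∈ degreeGE 𝒜 m :=
  Submodule.mem_iSup_of_mem (p := fun n : {n : ℕ // m ≤ n} => 𝒜 n) ⟨n, h⟩ hx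

theorem mul_mem_degreeGE [SetLike.GradedMonoid 𝒜] {m n : ℕ} {x y : A} (hx : x ∈ degreeGE 𝒜 m)
    (hy : y ∈ degreeGE 𝒜 n) : x * y ∈ degreeGE 𝒜 (m + n) := by
  have hle : degreeGE 𝒜 m * degreeGE 𝒜 n ≤ degreeGE 𝒜 (m + n) := by
    simp only [degreeGE, Submodule.iSup_mul, Submodule.mul_iSup]
    refine iSup_le fun j => iSup_le fun i => Submodule.mul_le.2 fun a ha b hb => ?_
    have hab : a * b ∈ 𝒜 (i.1 + j.1) := SetLike.mul_mem_graded ha hb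
    show a * b ∈ degreeGE 𝒜 (m + n)
    exact mem_degreeGE_of_mem (add_le_add i.2 j.2) hab
  exact hle (Submodule.mul_mem_mul hx hy)

theorem mem_degreeGE_zero [GradedAlgebra 𝒜] (x : A) : x ∈ degreeGE 𝒜 0 := by
  induction x using DirectSum.Decomposition.inductionOn 𝒜 with
  | zero => exact zero_mem _
  | homogeneous m => exact mem_degreeGE_of_mem (Nat.zero_le _) m.2
  | add a b ha hb => exact add_mem ha hb

theorem exists_eq_add_mem_degreeGE_one [GradedAlgebra 𝒜] (x : A) :
    ∃ a ∈ 𝒜 0, ∃ b ∈ degreeGE 𝒜 1, x = a + b := by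
  induction x using DirectSum.Decomposition.inductionOn 𝒜 with
  | zero => exact ⟨0, zero_mem _, 0, zero_mem _, by simp⟩
  | @homogeneous i m =>
    rcases Nat.eq_zero_or_pos i with rfl | hi
    · exact ⟨m, m.2, 0, zero_mem _, by simp⟩
    · exact ⟨0, zero_mem _, m, mem_degreeGE_of_mem hi m.2, by simp⟩
  | add x y hx hy =>
    obtain ⟨a, ha, b, hb, rfl⟩ := hx
    obtain ⟨a', ha', b', hb', rfl⟩ := hy
    exact ⟨a + a', add_mem ha ha', b + b', add_mem hb hb', by abel⟩

theorem degreeGE_eq_bot {c : ℕ} (htop : ∀ n : ℕ, c < n → 𝒜 n = ⊥) {m : ℕ}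
    (hm : c < m) : degreeGE 𝒜 m = ⊥ := by
  simp only [degreeGE, iSup_eq_bot]
  exact fun i => htop _ (lt_of_lt_of_le hm i.2)

theorem degreeGE_le_top_degree {c : ℕ} (htop : ∀ n : ℕ, c < n → 𝒜 n = ⊥) :
    degreeGE 𝒜 c ≤ 𝒜 c := by
  refine iSup_le fun i => ?_
  rcases i.2.eq_or_lt with h | h
  · rw [← h]
  · rw [htop _ h]
    exact bot_le

theorem eq_zero_of_mem_degreeGE_one_mul [GradedAlgebra 𝒜] {c : ℕ}
    (htop : ∀ n : ℕ, c < n → 𝒜 n = ⊥) {t x : A} (ht : t ∈ degreeGE 𝒜 1)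
    (h : t * x = x) : x = 0 := by
  have hx : ∀ m, x ∈ degreeGE 𝒜 m := by
    intro m
    induction m with
    | zero => exact mem_degreeGE_zero x
    | succ m ih =>
      rw [← h, add_comm]
      exact mul_mem_degreeGE ht ih
  have := hx (c + 1)
  rwa [degreeGE_eq_bot htop (Nat.lt_succ_self c), Submodule.mem_bot] at this

end DegreeFiltration

section GradedFrobenius

variable {k A : Type} [Field k] [Ring A] [Algebra k A] {𝒜 : ℕ → Submodule k A}

/-- Idempotents of degree zero with sum `1` that behave like a complete set of primitive
idempotents of a basic algebra. -/
structure IsBasicFamily (𝒜 : ℕ → Submodule k A) {ι : Type} [Fintype ι] (e : ι → A) : Prop where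
  mem : ∀ i, e i ∈ 𝒜 0
  idem : ∀ i, e i * e i = e i
  ne_zero : ∀ i, e i ≠ 0
  sum_eq_one : ∑ i, e i = 1
  nilpotent_or_inverse : ∀ i, ∀ r ∈ 𝒜 0, IsNilpotent (e i * r * e i) ∨
    ∃ u, u * (e i * r * e i) = e i ∧ (e i * r * e i) * u = e i
  nilpotent : ∀ i j, i ≠ j → ∀ r ∈ 𝒜 0, ∀ t ∈ 𝒜 0, IsNilpotent (e i * r * e j * t * e i)

theorem exists_isBasicFamily [FiniteDimensional k A] [GradedAlgebra 𝒜]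
    (hbasic : IsBasicAlgebra ↥(𝒜 0)) : ∃ (l : ℕ) (e : Fin l → A), IsBasicFamily 𝒜 e := by
  let ρ : ↥(𝒜 0) →+* A := (SetLike.GradeZero.subring 𝒜).subtype
  have hart : IsArtinianRing ↥(𝒜 0) :=
    IsArtinianRing.of_finite k ↥(SetLike.GradeZero.subalgebra 𝒜)
  obtain ⟨ι, _, p, hprim, horth, hsum⟩ :=
    IsIdempotentElem.exists_primitive_decomposition (1 : ↥(𝒜 0)) IsIdempotentElem.one
  let σ : Fin (Fintype.card ι) ≃ ι := (Fintype.equivFin ι).symm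
  have hb := hbasic _ (fun i => p (σ i)) (fun i => hprim _)
    (fun i j hij => horth _ _ (σ.injective.ne hij)) ((Equiv.sum_comp σ p).trans hsum)
  have hnil : ∀ x : ↥(𝒜 0), IsNilpotent x → IsNilpotent (x : A) := fun x hx => hx.map ρ
  refine ⟨Fintype.card ι, fun i => (p (σ i) : A), ⟨fun i => (p (σ i)).2, fun i => ?_,
    fun i h => ?_, ?_, fun i r hr => ?_, fun i j hij r hr t ht => ?_⟩⟩
  · exact congrArg Subtype.val (hprim (σ i)).1.eq
  · exact (hprim (σ i)).2.1 (Subtype.ext h)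
  · have h := congrArg ρ ((Equiv.sum_comp σ p).trans hsum)
    rw [map_sum] at h
    exact h
  · rcases (hprim (σ i)).isNilpotent_or_exists_inverse k ⟨r, hr⟩ with h | ⟨u, h1, h2⟩
    · exact Or.inl (hnil _ h)
    · exact Or.inr ⟨u, congrArg Subtype.val h1, congrArg Subtype.val h2⟩
  · exact hnil _ ((hprim (σ i)).isNilpotent_of_isEmpty_equiv k (hprim (σ j)) (hb i j hij)
      ⟨r, hr⟩ ⟨t, ht⟩)

theorem eq_zero_of_mul_isNilpotent_eq {x z : A} (hz : IsNilpotent z) (h : x * z = x) : x = 0 := by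
  obtain ⟨n, hn⟩ := hz
  have hx : ∀ m : ℕ, x * z ^ m = x := by
    intro m
    induction m with
    | zero => simp
    | succ m ih => rw [pow_succ, ← mul_assoc, ih, h]
  rw [← hx n, hn, mul_zero]

theorem eq_zero_of_isNilpotent_mul_eq {x z : A} (hz : IsNilpotent z) (h : z * x = x) : x = 0 := by
  obtain ⟨n, hn⟩ := hz
  have hx : ∀ m : ℕ, z ^ m * x = x := by
    intro m
    induction m with
    | zero => simp
    | succ m ih => rw [pow_succ, mul_assoc, h, ih]
  rw [← hx n, hn, zero_mul]

variable [GradedAlgebra 𝒜] {c : ℕ}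

theorem mul_eq_zero_of_mem_degreeGE_one (htop : ∀ n : ℕ, c < n → 𝒜 n = ⊥) {x t : A}
    (hx : x ∈ 𝒜 c) (ht : t ∈ degreeGE 𝒜 1) : x * t = 0 ∧ t * x = 0 := by
  have hx' := mem_degreeGE_of_mem le_rfl hx
  have h1 := mul_mem_degreeGE hx' ht
  have h2 := mul_mem_degreeGE ht hx'
  rw [degreeGE_eq_bot htop (by omega), Submodule.mem_bot] at h1 h2
  exact ⟨h1, h2⟩

theorem GeneratesSimple.mul_eq_zero_of_mem_degreeGE_one (htop : ∀ n : ℕ, c < n → 𝒜 n = ⊥) {x t : A}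
    (hx : GeneratesSimple x) (ht : t ∈ degreeGE 𝒜 1) : t * x = 0 := by
  by_contra h
  obtain ⟨b, hb⟩ := hx.2 t h
  have hbt : b * t ∈ degreeGE 𝒜 1 := by
    simpa using mul_mem_degreeGE (mem_degreeGE_zero b) ht
  exact hx.1 (eq_zero_of_mem_degreeGE_one_mul htop hbt (by rw [mul_assoc, hb]))

variable {ι : Type} [Fintype ι] {e : ι → A}

/-- In a left well-graded self-injective algebra, the left socle is concentrated in the top
degree. -/
theorem GeneratesSimple.mem_top_degree (htop : ∀ n : ℕ, c < n → 𝒜 n = ⊥)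
    (hinj : Module.Injective A A) (hwell : LeftWellGraded 𝒜 c) (he : IsBasicFamily 𝒜 e)
    {s : A} (hs : GeneratesSimple s) : s ∈ 𝒜 c := by
  obtain ⟨j, hj⟩ : ∃ j, e j * s ≠ 0 := by
    by_contra! h
    apply hs.1
    rw [← one_mul s, ← he.sum_eq_one, Finset.sum_mul]
    exact Finset.sum_eq_zero fun i _ => h i
  obtain ⟨y', hy', hey⟩ := hwell (e j) (he.mem j) (he.idem j) (he.ne_zero j)
  obtain ⟨y, hy⟩ : ∃ y, y = e j * y' := ⟨_, rfl⟩
  have hyc : y ∈ 𝒜 c := by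
    rw [hy]
    simpa using SetLike.mul_mem_graded (he.mem j) hy'
  have hjy : e j * y = y := by rw [hy, ← mul_assoc, he.idem]
  have hx := hs.mul_left hj
  obtain ⟨x, hxs⟩ : ∃ x, x = e j * s := ⟨_, rfl⟩
  rw [← hxs] at hx
  have hjx : e j * x = x := by rw [hxs, ← mul_assoc, he.idem]
  have hann : ∀ a, a * y = 0 → a * x = 0 := by
    intro a hay
    obtain ⟨a₀, ha₀, a₁, ha₁, rfl⟩ := exists_eq_add_mem_degreeGE_one (𝒜 := 𝒜) a
    rw [add_mul, (_root_.mul_eq_zero_of_mem_degreeGE_one htop hyc ha₁).2, add_zero] at hay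
    rw [add_mul, hx.mul_eq_zero_of_mem_degreeGE_one htop ha₁, add_zero]
    by_contra hax
    obtain ⟨b, hb⟩ := hx.2 a₀ hax
    obtain ⟨b₀, hb₀, b₁, hb₁, rfl⟩ := exists_eq_add_mem_degreeGE_one (𝒜 := 𝒜) b
    rw [add_mul, (hx.mul_left hax).mul_eq_zero_of_mem_degreeGE_one htop hb₁, add_zero] at hb
    have hba : b₀ * a₀ ∈ 𝒜 0 := by simpa using SetLike.mul_mem_graded hb₀ ha₀
    rcases he.nilpotent_or_inverse j (b₀ * a₀) hba with h | ⟨u, hu, -⟩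
    · refine hx.1 (eq_zero_of_isNilpotent_mul_eq h ?_)
      rw [mul_assoc, hjx, mul_assoc, mul_assoc, hb, hjx]
    · apply hey
      rw [← hy, ← hjy, ← hu]
      simp only [mul_assoc, hjy, hay, mul_zero]
  obtain ⟨r, hr⟩ := hinj.exists_mul_eq hann
  obtain ⟨b, hb⟩ := hs.2 (e j) hj
  apply degreeGE_le_top_degree htop
  rw [← hb, ← hxs, hr]
  have h1 := mul_mem_degreeGE (mem_degreeGE_of_mem le_rfl hyc) (mem_degreeGE_zero (𝒜 := 𝒜) r)
  simpa using mul_mem_degreeGE (mem_degreeGE_zero (𝒜 := 𝒜) b) h1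

theorem GeneratesSimple.mul_eq_zero_or (htop : ∀ n : ℕ, c < n → 𝒜 n = ⊥)
    (hinj : Module.Injective A A) (he : IsBasicFamily 𝒜 e) {s : A} (hs : GeneratesSimple s)
    (hsc : s ∈ 𝒜 c) {i j : ι} (hij : i ≠ j) : s * e i = 0 ∨ s * e j = 0 := by
  by_contra! h
  obtain ⟨hi, hj⟩ := h
  have hann : ∀ a x z, s * x ≠ 0 → a * (s * x) = 0 → a * (s * z) = 0 := by
    intro a x z hx ha
    have has : a * s = 0 := by
      by_contra h0
      obtain ⟨b, hb⟩ := hs.2 a h0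
      apply hx
      rw [← hb, mul_assoc, mul_assoc, ha, mul_zero]
    rw [← mul_assoc, has, zero_mul]
  have hdeg : ∀ x ∈ 𝒜 0, ∀ z, (∃ r, s * z = s * x * r) → ∃ r ∈ 𝒜 0, s * z = s * x * r := by
    rintro x hx z ⟨r, hr⟩
    obtain ⟨r₀, hr₀, r₁, hr₁, rfl⟩ := exists_eq_add_mem_degreeGE_one (𝒜 := 𝒜) r
    have hsx : s * x ∈ 𝒜 c := by simpa using SetLike.mul_mem_graded hsc hx
    rw [mul_add, (_root_.mul_eq_zero_of_mem_degreeGE_one htop hsx hr₁).1, add_zero] at hr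
    exact ⟨r₀, hr₀, hr⟩
  obtain ⟨r, hr, hsr⟩ := hdeg (e i) (he.mem i) (e j)
    (hinj.exists_mul_eq fun a => hann a (e i) (e j) hi)
  obtain ⟨t, ht, hst⟩ := hdeg (e j) (he.mem j) (e i)
    (hinj.exists_mul_eq fun a => hann a (e j) (e i) hj)
  refine hi (eq_zero_of_mul_isNilpotent_eq (he.nilpotent i j hij r hr t ht) ?_)
  calc s * e i * (e i * r * e j * t * e i) = s * (e i * e i) * r * e j * t * e i := by
        simp only [mul_assoc]
    _ = s * (e j * e j) * t * e i := by rw [he.idem, ← hsr, mul_assoc s]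
    _ = s * (e i * e i) := by rw [he.idem, ← hst, mul_assoc]
    _ = s * e i := by rw [he.idem]

theorem GeneratesSimple.exists_mul_eq_self (htop : ∀ n : ℕ, c < n → 𝒜 n = ⊥)
    (hinj : Module.Injective A A) (he : IsBasicFamily 𝒜 e) {s : A} (hs : GeneratesSimple s)
    (hsc : s ∈ 𝒜 c) : ∃ i, s * e i = s ∧ ∀ j, j ≠ i → s * e j = 0 := by
  have hsum : s = ∑ i, s * e i := by rw [← Finset.mul_sum, he.sum_eq_one, mul_one]
  obtain ⟨i, hi⟩ : ∃ i, s * e i ≠ 0 := by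
    by_contra! h
    exact hs.1 (hsum.trans (Finset.sum_eq_zero fun i _ => h i))
  have hzero : ∀ j, j ≠ i → s * e j = 0 := fun j hj =>
    (hs.mul_eq_zero_or htop hinj he hsc hj).resolve_right hi
  refine ⟨i, ?_, hzero⟩
  conv_rhs => rw [hsum]
  exact (Finset.sum_eq_single i (fun j _ hj => hzero j hj) (by simp)).symm

/-- The left ideals `A e_i` have simple socles. -/
theorem GeneratesSimple.exists_mul_eq (htop : ∀ n : ℕ, c < n → 𝒜 n = ⊥)
    (hinj : Module.Injective A A) (he : IsBasicFamily 𝒜 e) {s s' : A} (hs : GeneratesSimple s)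
    (hsc : s ∈ 𝒜 c) (hs' : GeneratesSimple s') (hsc' : s' ∈ 𝒜 c) {i : ι} (hi : s * e i = s)
    (hi' : s' * e i = s') : ∃ a, a * s' = s := by
  by_contra hcon
  obtain ⟨r, hr, hr'⟩ := hinj.exists_mul_eq_self_and_mul_eq_zero (x := s) (y := s') (by
    intro a b hab
    by_contra h0
    obtain ⟨d, hd⟩ := hs.2 a h0
    exact hcon ⟨d * b, by rw [mul_assoc, ← hab, hd]⟩)
  obtain ⟨r₀, hr₀, r₁, hr₁, rfl⟩ := exists_eq_add_mem_degreeGE_one (𝒜 := 𝒜) r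
  rw [mul_add, (_root_.mul_eq_zero_of_mem_degreeGE_one htop hsc hr₁).1, add_zero] at hr
  rw [mul_add, (_root_.mul_eq_zero_of_mem_degreeGE_one htop hsc' hr₁).1, add_zero] at hr'
  rcases he.nilpotent_or_inverse i r₀ hr₀ with h | ⟨u, -, hu⟩
  · refine hs.1 (eq_zero_of_mul_isNilpotent_eq h ?_)
    rw [← mul_assoc, ← mul_assoc, hi, hr, hi]
  · apply hs'.1
    rw [← hi', ← hu, ← mul_assoc, ← mul_assoc, ← mul_assoc, hi', hr', zero_mul, zero_mul]

theorem dual_smul_apply (a y : A) (f : Module.Dual k A) : (a • f) y = f (y * a) := rfl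

theorem exists_gradedFrobenius_of_leftWellGraded [FiniteDimensional k A]
    (htop : ∀ n : ℕ, c < n → 𝒜 n = ⊥) (hbasic : IsBasicAlgebra ↥(𝒜 0))
    (hinj : Module.Injective A A) (hwell : LeftWellGraded 𝒜 c) :
    ∃ φ : A ≃ₗ[A] Module.Dual k A,
      ∀ (n m : ℕ) (x y : A), x ∈ 𝒜 n → y ∈ 𝒜 m → n + m ≠ c → φ x y = 0 := by
  have hart : IsArtinianRing A := IsArtinianRing.of_finite k A
  obtain ⟨l, e, he⟩ := exists_isBasicFamily hbasic
  have hf : ∀ i, ∃ f : Module.Dual k A, ∀ s, GeneratesSimple s → s * e i = s →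
      ∃ a, f (a * s) ≠ 0 := by
    intro i
    by_cases hex : ∃ s₀, GeneratesSimple s₀ ∧ s₀ * e i = s₀
    · obtain ⟨s₀, hs₀, hi₀⟩ := hex
      obtain ⟨f, hf⟩ : ∃ f : Module.Dual k A, f s₀ ≠ 0 := by
        by_contra! h
        exact hs₀.1 ((Module.forall_dual_apply_eq_zero_iff k s₀).1 h)
      refine ⟨f, fun s hs hi => ?_⟩
      obtain ⟨a, ha⟩ := hs₀.exists_mul_eq htop hinj he
        (hs₀.mem_top_degree htop hinj hwell he) hs (hs.mem_top_degree htop hinj hwell he) hi₀ hi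
      exact ⟨a, by rwa [ha]⟩
    · exact ⟨0, fun s hs hi => (hex ⟨s, hs, hi⟩).elim⟩
  choose f hf using hf
  let F : Module.Dual k A :=
    ∑ i, (f i).comp ((LinearMap.mulRight k (e i)).comp (GradedAlgebra.proj 𝒜 c))
  have hFapply : ∀ y, F y = ∑ i, f i ((DirectSum.decompose 𝒜 y c : A) * e i) := by
    intro y
    simp [F, LinearMap.sum_apply]
  have hFc : ∀ y ∈ 𝒜 c, F y = ∑ i, f i (y * e i) := by
    intro y hy
    rw [hFapply, DirectSum.decompose_of_mem_same 𝒜 hy]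
  have hF0 : ∀ n, n ≠ c → ∀ y ∈ 𝒜 n, F y = 0 := by
    intro n hn y hy
    rw [hFapply, DirectSum.decompose_of_mem_ne 𝒜 hy hn]
    simp
  have hFs : ∀ s, GeneratesSimple s → ∃ a, F (a * s) ≠ 0 := by
    intro s hs
    have hsc := hs.mem_top_degree htop hinj hwell he
    obtain ⟨i, hi, hzero⟩ := hs.exists_mul_eq_self htop hinj he hsc
    obtain ⟨a, ha⟩ := hf i s hs hi
    refine ⟨a, ?_⟩
    have hasc : a * s ∈ 𝒜 c := by
      apply degreeGE_le_top_degree htop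
      simpa using
        mul_mem_degreeGE (mem_degreeGE_zero (𝒜 := 𝒜) a) (mem_degreeGE_of_mem le_rfl hsc)
    rw [hFc _ hasc, Finset.sum_eq_single i (fun j _ hj => ?_) (by simp), mul_assoc, hi]
    · exact ha
    · rw [mul_assoc, hzero j hj, mul_zero, map_zero]
  let ψ : A →ₗ[A] Module.Dual k A := LinearMap.toSpanSingleton A (Module.Dual k A) F
  have hψ : ∀ x y, ψ x y = F (y * x) := fun x y => rfl
  have hinjψ : Function.Injective ψ := by
    rw [injective_iff_map_eq_zero]
    intro x hx
    by_contra hx0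
    obtain ⟨a, ha⟩ := exists_mul_generatesSimple hx0
    obtain ⟨b, hb⟩ := hFs _ ha
    apply hb
    rw [← mul_assoc, ← hψ]
    exact congrArg (fun g : Module.Dual k A => g (b * a)) hx
  have hsurj : Function.Surjective ψ :=
    (LinearMap.injective_iff_surjective_of_finrank_eq_finrank (f := ψ.restrictScalars k)
      (Subspace.dual_finrank_eq (K := k) (V := A)).symm).1 hinjψ
  refine ⟨LinearEquiv.ofBijective ψ ⟨hinjψ, hsurj⟩, fun n m x y hx hy hnm => ?_⟩
  show F (y * x) = 0
  exact hF0 (m + n) (by omega) _ (SetLike.mul_mem_graded hy hx)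

/-- An algebra isomorphic to its dual as a left module is left self-injective. -/
theorem injective_of_equiv_dual (φ : A ≃ₗ[A] Module.Dual k A) : Module.Injective A A := by
  apply Module.Baer.injective
  intro I g
  let g₁ : I.restrictScalars k →ₗ[k] k :=
    { toFun := fun x => φ (g x) 1
      map_add' := fun x y => by
        have h : g (x + y) = g x + g y := map_add g x y
        rw [h, map_add, LinearMap.add_apply]
      map_smul' := fun r x => by
        have h : g (r • x) = r • g x := map_smul (g.restrictScalars k) r x
        have h' : φ (r • g x) = r • φ (g x) := map_smul (φ.toLinearMap.restrictScalars k) r _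
        rw [h, h', LinearMap.smul_apply, RingHom.id_apply] }
  obtain ⟨h, hh⟩ := LinearMap.exists_extend g₁
  refine ⟨LinearMap.toSpanSingleton A A (φ.symm h), fun x hx => ?_⟩
  apply φ.injective
  rw [LinearMap.toSpanSingleton_apply, map_smul, LinearEquiv.apply_symm_apply]
  ext y
  rw [dual_smul_apply]
  have h1 : h (y * x) = φ (g ⟨y * x, I.mul_mem_left y hx⟩) 1 :=
    LinearMap.congr_fun hh ⟨y * x, I.mul_mem_left y hx⟩
  have h2 : g ⟨y * x, I.mul_mem_left y hx⟩ = y • g ⟨x, hx⟩ := map_smul g y ⟨x, hx⟩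
  rw [h1, h2, map_smul, dual_smul_apply, one_mul]

/-- The top degree of a graded Frobenius algebra is faithful on both sides in degree zero. -/
theorem eq_zero_of_gradedFrobenius (φ : A ≃ₗ[A] Module.Dual k A)
    (hφ : ∀ (n m : ℕ) (x y : A), x ∈ 𝒜 n → y ∈ 𝒜 m → n + m ≠ c → φ x y = 0)
    {a : A} (ha : a ∈ 𝒜 0) (h : (∀ x ∈ 𝒜 c, a * x = 0) ∨ ∀ x ∈ 𝒜 c, x * a = 0) : a = 0 := by
  have hmul : ∀ x y, φ x y = φ 1 (y * x) := fun x y => by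
    rw [← dual_smul_apply, ← map_smul, smul_eq_mul, mul_one]
  rcases h with h | h
  · have h0 : ∀ x, φ x a = 0 := by
      intro x
      induction x using DirectSum.Decomposition.inductionOn 𝒜 with
      | zero => simp
      | @homogeneous i m =>
        by_cases hi : i = c
        · subst hi
          rw [hmul, h m m.2, map_zero]
        · exact hφ i 0 m a m.2 ha (by simpa using hi)
      | add x y hx hy => rw [map_add, LinearMap.add_apply, hx, hy, add_zero]
    refine (Module.forall_dual_apply_eq_zero_iff k a).1 fun f => ?_
    rw [← φ.apply_symm_apply f]
    exact h0 _
  · apply φ.injective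
    rw [map_zero]
    ext y
    induction y using DirectSum.Decomposition.inductionOn 𝒜 with
    | zero => simp
    | @homogeneous i m =>
      by_cases hi : i = c
      · subst hi
        rw [hmul, h m m.2, map_zero, LinearMap.zero_apply]
      · exact hφ 0 i a m ha m.2 (by simpa using hi)
    | add x y hx hy => rw [map_add, hx, hy, map_add]

end GradedFrobenius

theorem graded_frobenius_tfae
    (k : Type) [Field k] (A : Type) [Ring A] [Algebra k A] [FiniteDimensional k A]
    (𝒜 : ℕ → Submodule k A) [GradedAlgebra 𝒜]
    (c : ℕ) (hc : 1 ≤ c) (hcne : 𝒜 c ≠ ⊥) (htop : ∀ n : ℕ, c < n → 𝒜 n = ⊥)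
    (hbasic : IsBasicAlgebra ↥(𝒜 0)) :
    ((∃ φ : A ≃ₗ[A] Module.Dual k A,
        ∀ (n m : ℕ) (x y : A), x ∈ 𝒜 n → y ∈ 𝒜 m → n + m ≠ c → φ x y = 0) ↔
      (Module.Injective A A ∧
        ∀ a ∈ 𝒜 0, (∀ x ∈ 𝒜 c, a * x = 0) → a = 0)) ∧
    ((Module.Injective A A ∧
        ∀ a ∈ 𝒜 0, (∀ x ∈ 𝒜 c, a * x = 0) → a = 0) ↔
      (LeftWellGraded 𝒜 c ∧ RightWellGraded 𝒜 c ∧ Module.Injective A A)) := by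
  have hwell_of_faithful : (∀ a ∈ 𝒜 0, (∀ x ∈ 𝒜 c, a * x = 0) → a = 0) →
      LeftWellGraded 𝒜 c := by
    intro hfaith e he _ he0
    by_contra! h
    exact he0 (hfaith e he h)
  refine ⟨⟨?_, ?_⟩, ⟨?_, ?_⟩⟩
  · rintro ⟨φ, hφ⟩
    exact ⟨injective_of_equiv_dual φ,
      fun a ha h => eq_zero_of_gradedFrobenius φ hφ ha (Or.inl h)⟩
  · rintro ⟨hinj, hfaith⟩
    exact exists_gradedFrobenius_of_leftWellGraded htop hbasic hinj (hwell_of_faithful hfaith)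
  · rintro ⟨hinj, hfaith⟩
    obtain ⟨φ, hφ⟩ :=
      exists_gradedFrobenius_of_leftWellGraded htop hbasic hinj (hwell_of_faithful hfaith)
    refine ⟨hwell_of_faithful hfaith, fun e he _ he0 => ?_, hinj⟩
    by_contra! h
    exact he0 (eq_zero_of_gradedFrobenius φ hφ he (Or.inr h))
  · rintro ⟨hwell, -, hinj⟩
    obtain ⟨φ, hφ⟩ := exists_gradedFrobenius_of_leftWellGraded htop hbasic hinj hwell
    exact ⟨hinj, fun a ha h => eq_zero_of_gradedFrobenius φ hφ ha (Or.inl h)⟩
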